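/- arXiv:2203.13117 — 4 statements merged into one kernel-verified Lean document; each statement's English description precedes it below -/
import Mathlib

section
/- For any fixed nonzero real number α, the partial sums ∑_{p ≤ x} 1/p^{1+iα} over primes p are bounded uniformly in x ≥ 2, with implied constant depending only on α. -/
open Finset Complex

open ArithmeticFunction ArithmeticFunction.vonMangoldt LSeries in
/-- The difference between the L-series of `Λ` at `1 + δ + iα` and its
principal part stays bounded as `δ → 0⁺`. -/
lemma exists_norm_LSeries_vonMangoldt_sub_le (α : ℝ) :
    ∃ K : ℝ, ∀ δ : ℝ, 0 < δ → δ ≤ 2 →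
      ‖LSeries (fun n ↦ (vonMangoldt n : ℂ)) (1 + δ + I * α) - 1 / (δ + I * α)‖ ≤ K := by
  have hc : ContinuousOn (fun δ : ℝ ↦ LFunctionResidueClassAux (1 : ZMod 1) (1 + δ + I * α))
      (Set.Icc 0 2) :=
    (continuousOn_LFunctionResidueClassAux (1 : ZMod 1)).comp
      (by fun_prop) (fun δ hδ ↦ by simpa using hδ.1)
  obtain ⟨K, hK⟩ := isCompact_Icc.exists_bound_of_continuousOn hc
  refine ⟨K, fun δ h₀ h₂ ↦ ?_⟩
  have h := hK δ ⟨h₀.le, h₂⟩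
  rw [eqOn_LFunctionResidueClassAux isUnit_one (by simpa using h₀)] at h
  have hres : residueClass (1 : ZMod 1) = fun n ↦ vonMangoldt n := by
    ext n
    simp [residueClass, Set.indicator, Subsingleton.elim (n : ZMod 1) 1]
  simpa [hres, add_assoc] using h

/-- The indicator function of the primes, with complex values. -/
def primeIndicator (n : ℕ) : ℂ := if n.Prime then 1 else 0

lemma norm_primeIndicator_le_one (n : ℕ) : ‖primeIndicator n‖ ≤ 1 := by
  unfold primeIndicator; split_ifs <;> simp

lemma abscissaOfAbsConv_primeIndicator_le_one :
    LSeries.abscissaOfAbsConv primeIndicator ≤ 1 :=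
  LSeries.abscissaOfAbsConv_le_of_le_const
    ⟨1, fun n _ ↦ norm_primeIndicator_le_one n⟩

lemma abscissaOfAbsConv_primeIndicator_lt {s : ℂ} (hs : 1 < s.re) :
    LSeries.abscissaOfAbsConv primeIndicator < s.re :=
  abscissaOfAbsConv_primeIndicator_le_one.trans_lt (mod_cast hs)

open ArithmeticFunction ArithmeticFunction.vonMangoldt LSeries in
lemma exists_norm_LSeries_logMul_primeIndicator_sub_vonMangoldt_le :
    ∃ K : ℝ, ∀ s : ℂ, 1 < s.re →
      ‖LSeries (logMul primeIndicator) s - LSeries (fun n ↦ (vonMangoldt n : ℂ)) s‖ ≤ K := by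
  have hsum : Summable fun n : ℕ ↦ (if n.Prime then 0 else vonMangoldt n) / n := by
    refine (summable_residueClass_non_primes_div (1 : ZMod 1)).congr fun n ↦ ?_
    simp [residueClass, Set.indicator, Subsingleton.elim (n : ZMod 1) 1]
  refine ⟨∑' n : ℕ, (if n.Prime then 0 else vonMangoldt n) / n, fun s hs ↦ ?_⟩
  have h₁ : LSeriesSummable (logMul primeIndicator) s :=
    LSeriesSummable_logMul_of_lt_re (abscissaOfAbsConv_primeIndicator_lt hs)
  have h₂ := LSeriesSummable_vonMangoldt hs
  rw [LSeries, LSeries, ← h₁.tsum_sub h₂]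
  refine tsum_of_norm_bounded hsum.hasSum fun n ↦ ?_
  rcases eq_or_ne n 0 with rfl | hn
  · simp
  rw [term_of_ne_zero hn, term_of_ne_zero hn, ← sub_div]
  by_cases hp : n.Prime
  · simp [hp, logMul, primeIndicator, vonMangoldt_apply_prime hp, natCast_log]
  · have hn' : (1 : ℝ) ≤ n := mod_cast Nat.one_le_iff_ne_zero.mpr hn
    simp only [logMul, primeIndicator, hp, if_false, mul_zero, zero_sub, norm_div, norm_neg,
      norm_real, Real.norm_of_nonneg vonMangoldt_nonneg, norm_natCast_cpow_of_pos
      (Nat.pos_of_ne_zero hn)]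
    refine div_le_div_of_nonneg_left vonMangoldt_nonneg (by positivity) ?_
    simpa using Real.rpow_le_rpow_of_exponent_le hn' hs.le

lemma exists_norm_LSeries_logMul_primeIndicator_sub_le (α : ℝ) :
    ∃ K : ℝ, ∀ δ : ℝ, 0 < δ → δ ≤ 2 →
      ‖LSeries (LSeries.logMul primeIndicator) (1 + δ + I * α) - 1 / (δ + I * α)‖ ≤ K := by
  obtain ⟨K₁, h₁⟩ := exists_norm_LSeries_vonMangoldt_sub_le α
  obtain ⟨K₂, h₂⟩ := exists_norm_LSeries_logMul_primeIndicator_sub_vonMangoldt_le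
  refine ⟨K₂ + K₁, fun δ h₀ h ↦ ?_⟩
  rw [← sub_add_sub_cancel]
  exact (norm_add_le _ _).trans (add_le_add (h₂ _ (by simpa using h₀)) (h₁ δ h₀ h))

/-- The series `∑ p^{-s}` over primes stays bounded as `s → 1 + iα` horizontally. -/
lemma exists_norm_LSeries_primeIndicator_le {α : ℝ} (hα : α ≠ 0) :
    ∃ K : ℝ, ∀ δ : ℝ, 0 < δ → δ ≤ 2 → ‖LSeries primeIndicator (1 + δ + I * α)‖ ≤ K := by
  obtain ⟨K, hK⟩ := exists_norm_LSeries_logMul_primeIndicator_sub_le α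
  have hderiv (δ : ℝ) (hδ : δ ∈ Set.Ioc (0 : ℝ) 2) :
      HasDerivWithinAt (fun δ : ℝ ↦ LSeries primeIndicator (1 + δ + I * α))
        (-LSeries (LSeries.logMul primeIndicator) (1 + δ + I * α)) (Set.Ioc 0 2) δ := by
    have h := LSeries_hasDerivAt (abscissaOfAbsConv_primeIndicator_lt
      (s := 1 + δ + I * α) (by simpa using hδ.1))
    have h' : HasDerivAt (fun δ : ℝ ↦ (1 + δ + I * α : ℂ)) 1 δ :=
      (ofRealCLM.hasDerivAt.const_add 1).add_const _
    simpa [Function.comp_def] using (h.comp δ h').hasDerivWithinAt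
  have hbound (δ : ℝ) (hδ : δ ∈ Set.Ioc (0 : ℝ) 2) :
      ‖-LSeries (LSeries.logMul primeIndicator) (1 + δ + I * α)‖ ≤ K + 1 / |α| := by
    have h : ‖1 / (δ + I * α : ℂ)‖ ≤ 1 / |α| := by
      rw [norm_div, norm_one]
      have := abs_pos.mpr hα
      gcongr
      simpa using abs_im_le_norm (δ + I * α : ℂ)
    rw [norm_neg]
    linarith [hK δ hδ.1 hδ.2, norm_le_norm_sub_add
      (LSeries (LSeries.logMul primeIndicator) (1 + δ + I * α)) (1 / (δ + I * α : ℂ))]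
  have h2 : (2 : ℝ) ∈ Set.Ioc (0 : ℝ) 2 := by simp
  refine ⟨(K + 1 / |α|) * 2 + ‖LSeries primeIndicator (1 + (2 : ℝ) + I * α)‖, fun δ h₀ h ↦ ?_⟩
  have hmv := (convex_Ioc (0 : ℝ) 2).norm_image_sub_le_of_norm_hasDerivWithin_le
    hderiv hbound h2 ⟨h₀, h⟩
  refine (norm_le_norm_sub_add _ (LSeries primeIndicator (1 + (2 : ℝ) + I * α))).trans ?_
  gcongr
  refine hmv.trans ?_
  have hnn : 0 ≤ K + 1 / |α| := (norm_nonneg _).trans (hbound 2 h2)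
  gcongr
  rw [Real.norm_eq_abs, abs_le]
  constructor <;> linarith

/-- The summands of `∑ log p / p^{1+δ}`, indexed by all natural numbers. -/
noncomputable def primeLogTerm (δ : ℝ) (n : ℕ) : ℝ := if n.Prime then Real.log n / (n : ℝ) ^ (1 + δ) else 0

lemma term_logMul_primeIndicator (δ : ℝ) (n : ℕ) :
    LSeries.term (LSeries.logMul primeIndicator) (1 + δ) n = (primeLogTerm δ n : ℂ) := by
  by_cases hp : n.Prime
  · rw [LSeries.term_of_ne_zero hp.ne_zero]
    simp [LSeries.logMul, primeIndicator, primeLogTerm, hp, natCast_log,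
      ofReal_cpow n.cast_nonneg]
  · simp [LSeries.term, LSeries.logMul, primeIndicator, primeLogTerm, hp]

lemma summable_primeLogTerm {δ : ℝ} (hδ : 0 < δ) : Summable (primeLogTerm δ) := by
  have h : LSeriesSummable (LSeries.logMul primeIndicator) (1 + δ) :=
    LSeriesSummable_logMul_of_lt_re (abscissaOfAbsConv_primeIndicator_lt (by simpa using hδ))
  refine summable_ofReal.mp (h.congr fun n ↦ ?_)
  exact term_logMul_primeIndicator δ n

lemma exists_mul_tsum_primeLogTerm_le :
    ∃ K : ℝ, ∀ δ : ℝ, 0 < δ → δ ≤ 2 → δ * ∑' n, primeLogTerm δ n ≤ K := by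
  obtain ⟨K, hK⟩ := exists_norm_LSeries_logMul_primeIndicator_sub_le 0
  refine ⟨2 * K + 1, fun δ h₀ h ↦ ?_⟩
  have h' := hK δ h₀ h
  simp only [ofReal_zero, mul_zero, add_zero, LSeries, term_logMul_primeIndicator] at h'
  rw [← ofReal_tsum, ← ofReal_one, ← ofReal_div, ← ofReal_sub, norm_real] at h'
  have hK₀ : 0 ≤ K := (norm_nonneg _).trans h'
  calc δ * ∑' n, primeLogTerm δ n
      = δ * (∑' n, primeLogTerm δ n - 1 / δ) + 1 := by field_simp; ring
    _ ≤ 2 * K + 1 := by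
        have := (Real.le_norm_self _).trans h'
        nlinarith

lemma norm_inv_cpow_sub_inv_cpow_add_le {α δ : ℝ} {n : ℕ} (hn : 0 < n) :
    ‖1 / (n : ℂ) ^ (1 + I * α) - 1 / (n : ℂ) ^ (1 + δ + I * α)‖ ≤
      |1 - (n : ℝ) ^ (-δ)| / n := by
  have hn' : (n : ℂ) ≠ 0 := mod_cast hn.ne'
  have h : 1 / (n : ℂ) ^ (1 + I * α) - 1 / (n : ℂ) ^ (1 + δ + I * α) =
      ((1 - (n : ℝ) ^ (-δ) : ℝ) : ℂ) / (n : ℂ) ^ (1 + I * α) := by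
    rw [show (1 + δ + I * α : ℂ) = δ + (1 + I * α) by ring, cpow_add δ _ hn']
    push_cast
    rw [ofReal_cpow n.cast_nonneg]
    push_cast
    rw [cpow_neg, sub_div, ← div_div, one_div (_ ^ (δ : ℂ))]
  rw [h, norm_div, norm_real, norm_natCast_cpow_of_pos hn]
  simp

/-- Truncating at `x` and removing the shift `δ = 1 / log x` changes each term of
`∑ p^{-1-δ-iα}` by at most a constant multiple of `δ log p / p^{1+δ}`. -/
lemma norm_truncated_sub_term_le (α : ℝ) {x δ : ℝ} (hx : 1 < x) (hδ : δ = 1 / Real.log x)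
    (n : ℕ) :
    ‖(if n ∈ Finset.filter Nat.Prime (Finset.range (⌊x⌋₊ + 1)) then
        1 / (n : ℂ) ^ (1 + I * α) else 0) - LSeries.term primeIndicator (1 + δ + I * α) n‖ ≤
      Real.exp 1 * (δ * primeLogTerm δ n) := by
  have hlog : 0 < Real.log x := Real.log_pos hx
  have hδ₀ : 0 < δ := hδ ▸ by positivity
  by_cases hp : n.Prime
  swap
  · simp [hp, LSeries.term, primeIndicator, primeLogTerm]
  have hn : (0 : ℝ) < n := mod_cast hp.pos
  have hlogn : 0 ≤ Real.log n := Real.log_natCast_nonneg n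
  rw [LSeries.term_of_ne_zero hp.ne_zero]
  simp only [primeIndicator, primeLogTerm, hp, if_true, Finset.mem_filter, Finset.mem_range,
    and_true, Nat.lt_succ_iff, Nat.le_floor_iff (zero_le_one.trans hx.le)]
  split_ifs with hnx
  · refine (norm_inv_cpow_sub_inv_cpow_add_le hp.pos).trans ?_
    have hpow : (n : ℝ) ^ δ ≤ Real.exp 1 := by
      rw [Real.rpow_def_of_pos hn, Real.exp_le_exp, hδ, mul_one_div, div_le_one hlog]
      exact Real.log_le_log hn hnx
    have hle : |1 - (n : ℝ) ^ (-δ)| ≤ δ * Real.log n := by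
      have h₁ : (n : ℝ) ^ (-δ) ≤ 1 :=
        Real.rpow_le_one_of_one_le_of_nonpos (mod_cast hp.one_le) (by linarith)
      rw [abs_of_nonneg (by linarith), Real.rpow_def_of_pos hn]
      linarith [Real.add_one_le_exp (Real.log n * -δ)]
    calc |1 - (n : ℝ) ^ (-δ)| / n ≤ δ * Real.log n / n := by gcongr
      _ = (n : ℝ) ^ δ * (δ * (Real.log n / (n : ℝ) ^ (1 + δ))) := by
        rw [Real.rpow_add hn, Real.rpow_one]
        have := (Real.rpow_pos_of_pos hn δ).ne'
        field_simp
      _ ≤ _ := by gcongr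
  · rw [zero_sub, norm_neg, norm_div, norm_one, norm_natCast_cpow_of_pos hp.pos]
    have h₁ : 1 ≤ δ * Real.log n := by
      rw [hδ, one_div_mul_eq_div, one_le_div hlog]
      exact Real.log_le_log (by linarith) (not_le.mp hnx).le
    have h₂ : 1 ≤ Real.exp 1 := Real.one_le_exp zero_le_one
    calc _ = 1 * (1 / (n : ℝ) ^ (1 + δ)) := by simp
      _ ≤ (Real.exp 1 * (δ * Real.log n)) * (1 / (n : ℝ) ^ (1 + δ)) := by
        gcongr
        exact one_le_mul_of_one_le_of_one_le h₂ h₁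
      _ = _ := by ring

/-- For fixed nonzero real `α`, the sums `∑_{p ≤ x} 1 / p^{1+iα}` over primes `p` are
bounded uniformly in `x ≥ 2`, with constant depending only on `α`. -/
theorem sum_inv_prime_cpow_one_add_I_mul_bounded (α : ℝ) (hα : α ≠ 0) :
    ∃ C : ℝ, ∀ x : ℝ, 2 ≤ x →
      ‖∑ p ∈ Finset.filter Nat.Prime (Finset.range (⌊x⌋₊ + 1)),
          (1 : ℂ) / (p : ℂ) ^ ((1 : ℂ) + Complex.I * (α : ℂ))‖ ≤ C := by
  obtain ⟨K₁, h₁⟩ := exists_norm_LSeries_primeIndicator_le hα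
  obtain ⟨K₂, h₂⟩ := exists_mul_tsum_primeLogTerm_le
  refine ⟨Real.exp 1 * K₂ + K₁, fun x hx ↦ ?_⟩
  obtain ⟨δ, hδ⟩ : ∃ δ : ℝ, δ = 1 / Real.log x := ⟨_, rfl⟩
  have hlog2 : 1 / 2 ≤ Real.log x :=
    (by linarith [Real.log_two_gt_d9] : 1 / 2 ≤ Real.log 2).trans
      (Real.log_le_log two_pos hx)
  have hδ₀ : 0 < δ := hδ ▸ one_div_pos.mpr (by linarith)
  have hδ₂ : δ ≤ 2 := by
    rw [hδ, div_le_iff₀ (by linarith)]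
    linarith
  have hfin : HasSum (fun n ↦ if n ∈ Finset.filter Nat.Prime (Finset.range (⌊x⌋₊ + 1)) then
      1 / (n : ℂ) ^ (1 + I * α) else 0)
      (∑ p ∈ Finset.filter Nat.Prime (Finset.range (⌊x⌋₊ + 1)),
        (1 : ℂ) / (p : ℂ) ^ ((1 : ℂ) + Complex.I * (α : ℂ))) := by
    rw [← Finset.sum_congr rfl fun p hp ↦ if_pos hp]
    exact hasSum_sum_of_ne_finset_zero fun n hn ↦ if_neg hn
  have hser : LSeriesSummable primeIndicator (1 + δ + I * α) :=
    LSeriesSummable_of_abscissaOfAbsConv_lt_re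
      (abscissaOfAbsConv_primeIndicator_lt (by simpa using hδ₀))
  have hdiff := tsum_of_norm_bounded
    (((summable_primeLogTerm hδ₀).hasSum.mul_left δ).mul_left (Real.exp 1))
    (norm_truncated_sub_term_le α (by linarith) hδ)
  rw [(hfin.sub hser.hasSum).tsum_eq] at hdiff
  refine (norm_le_norm_sub_add _ (LSeries primeIndicator (1 + δ + I * α))).trans ?_
  refine add_le_add (hdiff.trans ?_) (h₁ δ hδ₀ hδ₂)
  gcongr
  exact h₂ δ hδ₀ hδ₂
end

section
/- For any fixed nonzero real number α, the sums ∑_{p ≤ x} cos(α ln p)/p over primes p ≤ x are bounded uniformly in x, with implied constant depending only on α. -/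
open Filter Topology

/-- The real part of `n ^ (-(σ + i t))`. -/
lemma re_natCast_cpow_neg {n : ℕ} (hn : n ≠ 0) (σ t : ℝ) :
    ((n : ℂ) ^ (-((σ : ℂ) + t * Complex.I))).re =
      (n : ℝ) ^ (-σ) * Real.cos (t * Real.log n) := by
  have hn' : (n : ℂ) ≠ 0 := by exact_mod_cast hn
  have hpos : (0 : ℝ) < n := by positivity
  have hre : (Complex.log n).re = Real.log n := by rw [← Complex.natCast_log, Complex.ofReal_re]
  have him : (Complex.log n).im = 0 := by rw [← Complex.natCast_log, Complex.ofReal_im]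
  rw [Complex.cpow_def_of_ne_zero hn', Complex.exp_re, Real.rpow_def_of_pos hpos]
  simp [hre, him, mul_comm]

lemma abs_ite_exp_sub_one_le {u : ℝ} (hu : 0 ≤ u) :
    |(if u ≤ 1 then Real.exp u else 0) - 1| ≤ 2 * u := by
  split_ifs with h
  · simpa [abs_of_nonneg hu] using Real.abs_exp_sub_one_le (x := u) (by rwa [abs_of_nonneg hu])
  · rw [zero_sub, abs_neg, abs_one]
    linarith

/-- Truncating `∑ cos(α log p) / p` at `x` and replacing the exponent `1` by `1 + 1 / log x` agree
up to `2 * (log p / log x) * p ^ (-(1 + 1 / log x))`. -/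
lemma abs_ite_cos_div_sub_re_cpow_le (α : ℝ) {x : ℝ} (hx : 1 < x) {n : ℕ} (hn : n ≠ 0) :
    |(if (n : ℝ) ≤ x then Real.cos (α * Real.log n) / n else 0) -
      ((n : ℂ) ^ (-(((1 + (Real.log x)⁻¹ : ℝ) : ℂ) + α * Complex.I))).re| ≤
      2 * (Real.log x)⁻¹ * (Real.log n * (n : ℝ) ^ (-(1 + (Real.log x)⁻¹))) := by
  rw [re_natCast_cpow_neg hn]
  set δ := (Real.log x)⁻¹
  have hlog : 0 < Real.log x := Real.log_pos hx
  have hpos : (0 : ℝ) < n := by positivity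
  have hlogn : 0 ≤ Real.log n := Real.log_natCast_nonneg n
  have hiff : (n : ℝ) ≤ x ↔ δ * Real.log n ≤ 1 := by
    rw [← Real.log_le_log_iff hpos (by linarith), inv_mul_le_one₀ hlog]
  have hdiv : Real.cos (α * Real.log n) / n =
      (n : ℝ) ^ (-(1 + δ)) * Real.cos (α * Real.log n) * Real.exp (δ * Real.log n) := by
    have : (n : ℝ) ^ (-(1 + δ)) * Real.exp (δ * Real.log n) = (n : ℝ)⁻¹ := by
      rw [mul_comm δ, ← Real.rpow_def_of_pos hpos, ← Real.rpow_add hpos,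
        show -(1 + δ) + δ = -1 by ring, Real.rpow_neg_one]
    rw [mul_right_comm, this]
    ring
  have hu : 0 ≤ δ * Real.log n := mul_nonneg (inv_nonneg.2 hlog.le) hlogn
  have hfac : (if (n : ℝ) ≤ x then Real.cos (α * Real.log n) / n else 0) -
      (n : ℝ) ^ (-(1 + δ)) * Real.cos (α * Real.log n) =
      ((n : ℝ) ^ (-(1 + δ)) * Real.cos (α * Real.log n)) *
        ((if δ * Real.log n ≤ 1 then Real.exp (δ * Real.log n) else 0) - 1) := by
    simp only [hiff, hdiv]
    split_ifs <;> ring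
  rw [hfac, abs_mul, abs_mul, abs_of_nonneg (Real.rpow_nonneg hpos.le _)]
  calc _ ≤ (n : ℝ) ^ (-(1 + δ)) * 1 * (2 * (δ * Real.log n)) := by
        gcongr
        · exact Real.abs_cos_le_one _
        · exact abs_ite_exp_sub_one_le hu
    _ = _ := by ring

lemma norm_term_vonMangoldt_prime (σ : ℝ) (p : Nat.Primes) :
    ‖LSeries.term (fun n ↦ (ArithmeticFunction.vonMangoldt n : ℂ)) σ p‖ =
      Real.log p * (p : ℝ) ^ (-σ) := by
  have hpos : (0 : ℝ) < (p : ℕ) := by exact_mod_cast p.prop.pos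
  rw [LSeries.term_of_ne_zero p.prop.ne_zero, norm_div,
    ArithmeticFunction.vonMangoldt_apply_prime p.prop, Complex.norm_real, Real.norm_eq_abs,
    abs_of_nonneg (Real.log_natCast_nonneg _), Complex.norm_natCast_cpow_of_pos p.prop.pos,
    Complex.ofReal_re, Real.rpow_neg hpos.le, div_eq_mul_inv]

lemma summable_log_mul_rpow_neg_primes {σ : ℝ} (hσ : 1 < σ) :
    Summable fun p : Nat.Primes ↦ Real.log p * (p : ℝ) ^ (-σ) := by
  have h := (ArithmeticFunction.LSeriesSummable_vonMangoldt (s := (σ : ℂ)) (by simpa)).norm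
  exact (h.comp_injective Nat.Primes.coe_nat_injective).congr
    fun p ↦ norm_term_vonMangoldt_prime σ p

lemma tsum_log_mul_rpow_neg_primes_le {σ : ℝ} (hσ : 1 < σ) :
    ∑' p : Nat.Primes, Real.log p * (p : ℝ) ^ (-σ) ≤
      ‖deriv riemannZeta σ / riemannZeta σ‖ := by
  have hs : LSeriesSummable (fun n ↦ (ArithmeticFunction.vonMangoldt n : ℂ)) σ :=
    ArithmeticFunction.LSeriesSummable_vonMangoldt (by simpa)
  have hterm (n : ℕ) : LSeries.term (fun n ↦ (ArithmeticFunction.vonMangoldt n : ℂ)) σ n =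
      (‖LSeries.term (fun n ↦ (ArithmeticFunction.vonMangoldt n : ℂ)) σ n‖ : ℝ) := by
    rcases eq_or_ne n 0 with rfl | hn
    · simp
    · rw [LSeries.term_of_ne_zero hn, norm_div, Complex.norm_real, Real.norm_eq_abs,
        abs_of_nonneg ArithmeticFunction.vonMangoldt_nonneg,
        Complex.norm_natCast_cpow_of_pos (Nat.pos_of_ne_zero hn), Complex.ofReal_re,
        Complex.ofReal_div, Complex.ofReal_cpow (Nat.cast_nonneg n), Complex.ofReal_natCast]
  have hL := ArithmeticFunction.LSeries_vonMangoldt_eq_deriv_riemannZeta_div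
    (s := (σ : ℂ)) (by simpa)
  rw [← norm_neg, ← neg_div, ← hL, LSeries, tsum_congr hterm, ← Complex.ofReal_tsum,
    Complex.norm_real]
  refine le_trans (le_of_eq ?_) ((hs.norm.tsum_subtype_le _ {p : ℕ | p.Prime}
    (fun _ ↦ norm_nonneg _)).trans (le_abs_self _))
  exact tsum_congr fun p ↦ (norm_term_vonMangoldt_prime σ p).symm

lemma exists_eventually_mul_tsum_log_mul_rpow_neg_primes_le :
    ∃ B : ℝ, ∀ᶠ δ : ℝ in 𝓝[>] 0,
      δ * ∑' p : Nat.Primes, Real.log p * (p : ℝ) ^ (-(1 + δ)) ≤ B := by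
  obtain ⟨c, hc⟩ := log_deriv_riemannZeta_add_inv_sub_bounded.bound
  have hmap : Tendsto (fun δ : ℝ ↦ ((1 + δ : ℝ) : ℂ)) (𝓝[>] 0) (𝓝[≠] 1) := by
    refine tendsto_nhdsWithin_iff.2 ⟨?_, ?_⟩
    · have : Continuous fun δ : ℝ ↦ ((1 + δ : ℝ) : ℂ) := by fun_prop
      simpa using (this.tendsto 0).mono_left nhdsWithin_le_nhds
    · filter_upwards [self_mem_nhdsWithin] with δ hδ
      have : δ ≠ 0 := ne_of_gt hδ
      simpa using this
  refine ⟨1 + |c|, ?_⟩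
  filter_upwards [hmap.eventually hc, Ioo_mem_nhdsGT (zero_lt_one' ℝ)] with δ h hδ
  have hle := tsum_log_mul_rpow_neg_primes_le (σ := 1 + δ) (by linarith [hδ.1])
  have hinv : ‖(((1 + δ : ℝ) : ℂ) - 1)⁻¹‖ = δ⁻¹ := by
    simp [abs_of_pos hδ.1]
  have htri := norm_sub_le (deriv riemannZeta ((1 + δ : ℝ) : ℂ) / riemannZeta ((1 + δ : ℝ) : ℂ) +
    (((1 + δ : ℝ) : ℂ) - 1)⁻¹) (((1 + δ : ℝ) : ℂ) - 1)⁻¹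
  rw [add_sub_cancel_right, hinv] at htri
  rw [norm_one, mul_one] at h
  calc _ ≤ δ * (|c| + δ⁻¹) := by
        gcongr
        · exact hδ.1.le
        · linarith [le_abs_self c]
    _ = 1 + δ * |c| := by rw [mul_add, mul_inv_cancel₀ hδ.1.ne']; ring
    _ ≤ _ := by nlinarith [hδ.2, abs_nonneg c]

lemma norm_prime_cpow_neg_le_inv {s : ℂ} (hs : 1 < s.re) (p : Nat.Primes) :
    ‖((p : ℕ) : ℂ) ^ (-s)‖ ≤ (p : ℝ)⁻¹ := by
  rw [Complex.norm_natCast_cpow_of_pos p.prop.pos, ← Real.rpow_neg_one]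
  refine Real.rpow_le_rpow_of_exponent_le (by exact_mod_cast p.prop.one_le) ?_
  rw [Complex.neg_re]
  linarith

lemma summable_prime_cpow_neg {s : ℂ} (hs : 1 < s.re) :
    Summable fun p : Nat.Primes ↦ ((p : ℕ) : ℂ) ^ (-s) := by
  refine .of_norm ((Nat.Primes.summable_rpow (r := -s.re)).2 (by linarith) |>.congr fun p ↦ ?_)
  rw [Complex.norm_natCast_cpow_of_pos p.prop.pos, Complex.neg_re]

lemma norm_neg_log_one_sub_sub_self_le {z : ℂ} (hz : ‖z‖ ≤ 1 / 2) :
    ‖-Complex.log (1 - z) - z‖ ≤ ‖z‖ ^ 2 := by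
  have h := Complex.norm_log_one_add_sub_self_le (z := -z) (by rw [norm_neg]; linarith)
  rw [norm_neg, ← sub_eq_add_neg, ← norm_neg] at h
  have hinv : (1 - ‖z‖)⁻¹ ≤ 2 := by
    rw [inv_le_comm₀ (by linarith) two_pos]
    linarith
  calc _ = ‖-(Complex.log (1 - z) - -z)‖ := by congr 1; ring
    _ ≤ _ := h
    _ ≤ ‖z‖ ^ 2 * 2 / 2 := by gcongr
    _ = _ := by ring

/-- The prime zeta function agrees with `log ζ` up to a bounded error. -/
lemma abs_re_tsum_prime_cpow_sub_log_norm_riemannZeta_le {s : ℂ} (hs : 1 < s.re) :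
    |(∑' p : Nat.Primes, ((p : ℕ) : ℂ) ^ (-s)).re - Real.log ‖riemannZeta s‖| ≤
      ∑' p : Nat.Primes, (p : ℝ)⁻¹ ^ 2 := by
  have hsum := summable_prime_cpow_neg hs
  have hlog : Summable fun p : Nat.Primes ↦ -Complex.log (1 - ((p : ℕ) : ℂ) ^ (-s)) :=
    hsum.clog_one_sub.neg
  have hsq : Summable fun p : Nat.Primes ↦ (p : ℝ)⁻¹ ^ 2 := by
    refine ((Nat.Primes.summable_rpow (r := -2)).2 (by norm_num)).congr fun p ↦ ?_
    rw [Real.rpow_neg (Nat.cast_nonneg _), inv_pow]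
    norm_cast
  rw [← riemannZeta_eulerProduct_exp_log hs, Complex.norm_exp, Real.log_exp, abs_sub_comm,
    ← Complex.sub_re, ← hlog.tsum_sub hsum]
  refine (Complex.abs_re_le_norm _).trans (tsum_of_norm_bounded hsq.hasSum fun p ↦ ?_)
  have hp := norm_prime_cpow_neg_le_inv hs p
  have h2 : ((p : ℕ) : ℝ)⁻¹ ≤ 1 / 2 := by
    rw [one_div]
    exact inv_anti₀ two_pos (by exact_mod_cast p.prop.two_le)
  exact (norm_neg_log_one_sub_sub_self_le (hp.trans h2)).trans (by gcongr)

lemma exists_eventually_abs_log_norm_riemannZeta_le {α : ℝ} (hα : α ≠ 0) :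
    ∃ B : ℝ, ∀ᶠ δ : ℝ in 𝓝[>] 0,
      |Real.log ‖riemannZeta (((1 + δ : ℝ) : ℂ) + α * Complex.I)‖| ≤ B := by
  have hne : ((1 + (0 : ℝ) : ℝ) : ℂ) + α * Complex.I ≠ 1 := fun h ↦ hα <| by
    simpa using congrArg Complex.im h
  have hzeta : riemannZeta (((1 + (0 : ℝ) : ℝ) : ℂ) + α * Complex.I) ≠ 0 :=
    riemannZeta_ne_zero_of_one_le_re (by simp)
  have hcont : ContinuousAt
      (fun δ : ℝ ↦ |Real.log ‖riemannZeta (((1 + δ : ℝ) : ℂ) + α * Complex.I)‖|) 0 := by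
    have h : ContinuousAt (fun δ : ℝ ↦ riemannZeta (((1 + δ : ℝ) : ℂ) + α * Complex.I)) 0 :=
      ContinuousAt.comp (f := fun δ : ℝ ↦ ((1 + δ : ℝ) : ℂ) + α * Complex.I)
        (differentiableAt_riemannZeta hne).continuousAt (by fun_prop)
    exact (h.norm.log (norm_ne_zero_iff.2 hzeta)).abs
  exact ⟨_, nhdsWithin_le_nhds ((hcont.eventually_lt continuousAt_const (lt_add_one _)).mono
    fun _ h ↦ h.le)⟩

lemma hasSum_primes_ite_le (f : ℕ → ℝ) {x : ℝ} (hx : 0 ≤ x) :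
    HasSum (fun p : Nat.Primes ↦ if ((p : ℕ) : ℝ) ≤ x then f p else 0)
      (∑ p ∈ Finset.filter Nat.Prime (Finset.range (⌊x⌋₊ + 1)), f p) := by
  have hmem (n : ℕ) : n ∈ Finset.range (⌊x⌋₊ + 1) ↔ (n : ℝ) ≤ x := by
    rw [Finset.mem_range, Nat.lt_succ_iff, Nat.le_floor_iff hx]
  have h : HasSum ({p : ℕ | p.Prime}.indicator fun n : ℕ ↦ if (n : ℝ) ≤ x then f n else 0)
      (∑ n ∈ Finset.range (⌊x⌋₊ + 1),
        {p : ℕ | p.Prime}.indicator (fun n : ℕ ↦ if (n : ℝ) ≤ x then f n else 0) n) :=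
    hasSum_sum_of_ne_finset_zero fun n hn ↦ by
      rw [hmem] at hn
      simp [Set.indicator, hn]
  convert! hasSum_subtype_iff_indicator.2 h using 1
  rw [Finset.sum_filter]
  refine Finset.sum_congr rfl fun n hn ↦ ?_
  rw [hmem] at hn
  simp [Set.indicator, hn]

/-- For fixed nonzero real `α`, the sums `∑_{p ≤ x} cos(α ln p)/p` over primes `p ≤ x`
are bounded uniformly in `x`, with constant depending only on `α`. -/
theorem sum_cos_mul_log_prime_div_bounded (α : ℝ) (hα : α ≠ 0) :
    ∃ C : ℝ, ∀ x : ℝ,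
      |∑ p ∈ Finset.filter Nat.Prime (Finset.range (⌊x⌋₊ + 1)),
          Real.cos (α * Real.log p) / p| ≤ C := by
  obtain ⟨A, hA⟩ := exists_eventually_mul_tsum_log_mul_rpow_neg_primes_le
  obtain ⟨B, hB⟩ := exists_eventually_abs_log_norm_riemannZeta_le hα
  have hlim : Tendsto (fun x : ℝ ↦ (Real.log x)⁻¹) atTop (𝓝[>] 0) :=
    tendsto_inv_atTop_nhdsGT_zero.comp Real.tendsto_log_atTop
  obtain ⟨X, hX⟩ := eventually_atTop.1 <|
    (hlim.eventually hA).and ((hlim.eventually hB).and (eventually_gt_atTop (1 : ℝ)))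
  set D := ∑' p : Nat.Primes, (p : ℝ)⁻¹ ^ 2
  refine ⟨max (2 * A + D + B) (∑ p ∈ Finset.range (⌊X⌋₊ + 1), (p : ℝ)⁻¹), fun x ↦ ?_⟩
  rcases le_total X x with hXx | hxX
  · obtain ⟨hA, hB, hx⟩ := hX x hXx
    refine le_max_of_le_left ?_
    set δ := (Real.log x)⁻¹
    have hσ : 1 < 1 + δ := by linarith [inv_pos.2 (Real.log_pos hx)]
    have hs : 1 < (((1 + δ : ℝ) : ℂ) + α * Complex.I).re := by simpa using hσ
    have hzeta := abs_re_tsum_prime_cpow_sub_log_norm_riemannZeta_le hs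
    have hdiff := (hasSum_primes_ite_le (fun n ↦ Real.cos (α * Real.log n) / n)
      (zero_le_one.trans hx.le)).sub (Complex.hasSum_re (summable_prime_cpow_neg hs).hasSum)
    have hbound := hdiff.norm_le_of_bounded
      ((summable_log_mul_rpow_neg_primes hσ).hasSum.mul_left (2 * δ))
      fun p ↦ abs_ite_cos_div_sub_re_cpow_le α hx p.prop.ne_zero
    rw [Real.norm_eq_abs, mul_assoc] at hbound
    rw [abs_le] at *
    constructor <;> linarith [hbound.1, hbound.2, hzeta.1, hzeta.2, hB.1, hB.2]
  · refine le_max_of_le_right ((Finset.abs_sum_le_sum_abs _ _).trans ?_)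
    calc _ ≤ ∑ p ∈ Finset.filter Nat.Prime (Finset.range (⌊x⌋₊ + 1)), (p : ℝ)⁻¹ := by
          refine Finset.sum_le_sum fun p _ ↦ ?_
          rw [abs_div, Nat.abs_cast, div_eq_mul_inv]
          exact mul_le_of_le_one_left (by positivity) (Real.abs_cos_le_one _)
      _ ≤ _ := by
          refine Finset.sum_le_sum_of_subset_of_nonneg ?_ fun _ _ _ ↦ by positivity
          exact (Finset.filter_subset _ _).trans
            (Finset.range_mono (Nat.succ_le_succ (Nat.floor_mono hxX)))
end

section
/- For any real numbers α ≠ α', the distance D(n^{iα}, n^{iα'}; x)² = ∑_{p ≤ x} (1 − cos((α − α') ln p))/p tends to infinity as x → ∞. -/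
open Finset Filter

/-- Compare the distances from `1` to `r` and to the point of argument `-θ` on the circle of
radius `r`. -/
lemma norm_one_sub_mul_exp_le {r : ℝ} (hr₀ : 0 ≤ r) (hr : r ≤ 1 / 2) (θ : ℝ) :
    ‖1 - (r : ℂ) * Complex.exp (-(θ * Complex.I))‖ ≤
      Real.exp (4 * (r * (1 - Real.cos θ))) * (1 - r) := by
  have hcos : 0 ≤ 1 - Real.cos θ := sub_nonneg.2 (Real.cos_le_one θ)
  have hexp : Complex.exp (-(θ * Complex.I)) = ⟨Real.cos θ, -Real.sin θ⟩ := by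
    rw [← neg_mul, ← Complex.ofReal_neg]
    apply Complex.ext
    · rw [Complex.exp_ofReal_mul_I_re, Real.cos_neg]
    · rw [Complex.exp_ofReal_mul_I_im, Real.sin_neg]
  have hsq : ‖1 - (r : ℂ) * Complex.exp (-(θ * Complex.I))‖ ^ 2 =
      (1 - r) ^ 2 + 2 * (r * (1 - Real.cos θ)) := by
    rw [Complex.sq_norm, hexp, Complex.normSq_apply]
    simp only [Complex.sub_re, Complex.sub_im, Complex.one_re, Complex.one_im,
      Complex.re_ofReal_mul, Complex.im_ofReal_mul]
    linear_combination r ^ 2 * Real.sin_sq_add_cos_sq θ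
  refine le_of_sq_le_sq ?_ (mul_nonneg (Real.exp_pos _).le (by linarith))
  set t := r * (1 - Real.cos θ)
  have ht₀ : 0 ≤ t := mul_nonneg hr₀ hcos
  have h8 : 8 * t + 1 ≤ Real.exp (4 * t) ^ 2 := by
    rw [← Real.exp_nat_mul]
    refine (Real.add_one_le_exp _).trans (le_of_eq ?_)
    push_cast
    ring_nf
  have h14 : 1 / 4 ≤ (1 - r) ^ 2 := by nlinarith
  rw [hsq, mul_pow]
  calc (1 - r) ^ 2 + 2 * t ≤ (8 * t + 1) * (1 - r) ^ 2 := by nlinarith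
    _ ≤ _ := by gcongr

lemma norm_eulerFactor_le {p : ℕ} (hp : p.Prime) {σ : ℝ} (hσ : 1 < σ) (γ : ℝ) :
    ‖(1 - (p : ℂ) ^ (-(σ : ℂ)))⁻¹‖ ≤
      Real.exp (4 * ((1 - Real.cos (γ * Real.log p)) / p)) *
        ‖(1 - (p : ℂ) ^ (-((σ : ℂ) + γ * Complex.I)))⁻¹‖ := by
  have hp₀ : (0 : ℝ) < p := mod_cast hp.pos
  have hpc : (p : ℂ) ≠ 0 := mod_cast hp.ne_zero
  have hp₂ : (2 : ℝ) ≤ p := mod_cast hp.two_le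
  set r : ℝ := (p : ℝ) ^ (-σ) with hr_def
  have hr₀ : 0 < r := Real.rpow_pos_of_pos hp₀ _
  have hr_inv : r ≤ (p : ℝ)⁻¹ := by
    rw [← Real.rpow_neg_one]
    exact Real.rpow_le_rpow_of_exponent_le (by linarith) (by linarith)
  have hr : r ≤ 1 / 2 := hr_inv.trans (by rw [one_div]; gcongr)
  have hcpow : (p : ℂ) ^ (-(σ : ℂ)) = r := by
    rw [hr_def, Complex.ofReal_cpow hp₀.le]
    push_cast
    rfl
  have htwist : (p : ℂ) ^ (-((σ : ℂ) + γ * Complex.I)) =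
      r * Complex.exp (-((γ * Real.log p : ℝ) * Complex.I)) := by
    rw [neg_add, Complex.cpow_add _ _ hpc, hcpow, Complex.cpow_def_of_ne_zero hpc,
      ← Complex.natCast_log]
    push_cast
    ring_nf
  have hcos : 0 ≤ 1 - Real.cos (γ * Real.log p) := sub_nonneg.2 (Real.cos_le_one _)
  have hne : 0 < ‖1 - (p : ℂ) ^ (-((σ : ℂ) + γ * Complex.I))‖ := by
    rw [norm_pos_iff, sub_ne_zero]
    intro h
    have hnorm := congrArg norm h
    rw [htwist, norm_mul, ← neg_mul, ← Complex.ofReal_neg, Complex.norm_exp_ofReal_mul_I,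
      Complex.norm_real, Real.norm_of_nonneg hr₀.le, norm_one] at hnorm
    linarith
  have hone : ‖1 - (p : ℂ) ^ (-(σ : ℂ))‖ = 1 - r := by
    rw [hcpow, ← Complex.ofReal_one, ← Complex.ofReal_sub, Complex.norm_real,
      Real.norm_of_nonneg (by linarith)]
  rw [norm_inv, norm_inv, hone, ← div_eq_mul_inv, le_div_iff₀ hne, inv_mul_le_iff₀ (by linarith),
    mul_comm (1 - r), htwist]
  refine (norm_one_sub_mul_exp_le hr₀.le hr _).trans ?_
  have hr₁ : 0 ≤ 1 - r := by linarith
  gcongr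
  rw [div_eq_mul_inv, mul_comm]
  gcongr

/-- A bound on `∑ (1 - cos (γ log p)) / p` bounds `ζ(σ)` by `ζ(σ + iγ)` to the right of `1`. -/
lemma norm_riemannZeta_le_of_sum_le {γ B : ℝ}
    (hB : ∀ n : ℕ, ∑ p ∈ Nat.primesBelow n, (1 - Real.cos (γ * Real.log p)) / p ≤ B)
    {σ : ℝ} (hσ : 1 < σ) :
    ‖riemannZeta σ‖ ≤ Real.exp (4 * B) * ‖riemannZeta (σ + γ * Complex.I)‖ := by
  have h₁ := (riemannZeta_eulerProduct (s := (σ : ℂ)) (by simpa using hσ)).norm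
  have h₂ := (riemannZeta_eulerProduct (s := (σ : ℂ) + γ * Complex.I) (by simpa using hσ)).norm
  refine le_of_tendsto_of_tendsto' h₁ (h₂.const_mul _) fun n ↦ ?_
  rw [norm_prod, norm_prod]
  calc _ ≤ ∏ p ∈ Nat.primesBelow n, (Real.exp (4 * ((1 - Real.cos (γ * Real.log p)) / p)) *
        ‖(1 - (p : ℂ) ^ (-((σ : ℂ) + γ * Complex.I)))⁻¹‖) :=
        prod_le_prod (fun _ _ ↦ norm_nonneg _) fun p hp ↦
          norm_eulerFactor_le (Nat.prime_of_mem_primesBelow hp) hσ γ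
    _ ≤ _ := by
        rw [prod_mul_distrib, ← Real.exp_sum, ← mul_sum]
        gcongr
        exact hB n

lemma not_bounded_sum_one_sub_cos_log_div_prime {γ : ℝ} (hγ : γ ≠ 0) (B : ℝ) :
    ∃ n : ℕ, B < ∑ p ∈ Nat.primesBelow n, (1 - Real.cos (γ * Real.log p)) / p := by
  by_contra! hB
  have hlim : Tendsto (fun σ : ℝ ↦ (σ : ℂ)) (nhdsWithin 1 (Set.Ioi 1)) (nhdsWithin 1 {1}ᶜ) := by
    refine tendsto_nhdsWithin_iff.2 ⟨?_, ?_⟩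
    · exact (Complex.continuous_ofReal.tendsto' 1 1 (by simp)).mono_left nhdsWithin_le_nhds
    · filter_upwards [self_mem_nhdsWithin] with σ hσ
      simpa using (Set.mem_Ioi.1 hσ).ne'
  have h₁ := (riemannZeta_residue_one.comp hlim).norm
  have hne : (1 : ℂ) + γ * Complex.I ≠ 1 := by simpa using hγ
  have hcont : ContinuousAt (fun s : ℂ ↦ (s - 1) * riemannZeta (s + γ * Complex.I)) 1 := by
    refine (continuousAt_id.sub continuousAt_const).mul ?_
    exact ContinuousAt.comp (f := fun s : ℂ ↦ s + γ * Complex.I)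
      (differentiableAt_riemannZeta hne).continuousAt (by fun_prop)
  have h₂ := ((hcont.tendsto.mono_left nhdsWithin_le_nhds).comp hlim).norm.const_mul
    (Real.exp (4 * B))
  have hle := le_of_tendsto_of_tendsto h₁ h₂ <| by
    filter_upwards [self_mem_nhdsWithin] with σ hσ
    simp only [Function.comp_apply, norm_mul]
    rw [mul_left_comm]
    gcongr
    exact norm_riemannZeta_le_of_sum_le hB hσ
  norm_num at hle

/-- For `α ≠ α'`, `D(n^{iα}, n^{iα'}; x)² = ∑_{p ≤ x} (1 − cos((α − α') ln p))/p → ∞`. -/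
theorem dist_nialpha_tendsto_atTop (α α' : ℝ) (hαα' : α ≠ α') :
    Tendsto (fun x : ℝ =>
        ∑ p ∈ Finset.filter Nat.Prime (Finset.range (⌊x⌋₊ + 1)),
          (1 - Real.cos ((α - α') * Real.log p)) / p)
      atTop atTop := by
  have hnonneg (p : ℕ) : 0 ≤ (1 - Real.cos ((α - α') * Real.log p)) / p :=
    div_nonneg (sub_nonneg.2 (Real.cos_le_one _)) p.cast_nonneg
  refine tendsto_atTop_atTop_of_monotone (fun x y hxy ↦ ?_) fun B ↦ ?_
  · refine sum_le_sum_of_subset_of_nonneg (filter_subset_filter _ ?_) fun p _ _ ↦ hnonneg p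
    exact range_subset_range.2 (Nat.add_le_add_right (Nat.floor_mono hxy) 1)
  · obtain ⟨n, hn⟩ := not_bounded_sum_one_sub_cos_log_div_prime (sub_ne_zero.2 hαα') B
    refine ⟨n, hn.le.trans ?_⟩
    rw [Nat.floor_natCast]
    refine sum_le_sum_of_subset_of_nonneg (filter_subset_filter _ ?_) fun p _ _ ↦ hnonneg p
    exact range_subset_range.2 n.le_succ
end

section
/- Let γ ≠ 0 be real and let (c_p) be bounded reals indexed by primes with (1/π(x)) ∑_{p ≤ x} c_p → K₀ as x → ∞ for some constant K₀. Then ∑_{p ≤ x} c_p cos(γ ln p)/p = o(ln ln x) as x → ∞. -/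
open Finset Filter Asymptotics

/-- `∑ Λ(n) n^{-(1+δ)} = O(1/δ)`. -/
lemma exists_tsum_vonMangoldt_le : ∃ B : ℝ, ∀ δ ∈ Set.Ioc (0 : ℝ) 1,
    Summable (fun n : ℕ ↦ ArithmeticFunction.vonMangoldt n / (n : ℝ) ^ (1 + δ)) ∧
    ∑' n : ℕ, ArithmeticFunction.vonMangoldt n / (n : ℝ) ^ (1 + δ) ≤ B / δ := by
  open ArithmeticFunction.vonMangoldt in
  have hres (n : ℕ) : residueClass (1 : ZMod 1) n = ArithmeticFunction.vonMangoldt n := by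
    simp [residueClass, Subsingleton.elim _ (1 : ZMod 1)]
  have hcont : ContinuousOn (fun x : ℝ ↦ (LFunctionResidueClassAux (1 : ZMod 1) x).re)
      (Set.Icc 1 2) :=
    Complex.continuous_re.comp_continuousOn
      ((continuousOn_LFunctionResidueClassAux (1 : ZMod 1)).comp
        Complex.continuous_ofReal.continuousOn fun x hx ↦ by simpa using hx.1)
  obtain ⟨C, hC⟩ := isCompact_Icc.exists_bound_of_continuousOn hcont
  refine ⟨C + 1, fun δ hδ ↦ ?_⟩
  have h1 : (1 : ℝ) < ((1 + δ : ℝ) : ℂ).re := by simpa using hδ.1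
  have hterm (n : ℕ) : LSeries.term (fun n ↦ (ArithmeticFunction.vonMangoldt n : ℂ))
      ((1 + δ : ℝ) : ℂ) n = ((ArithmeticFunction.vonMangoldt n / (n : ℝ) ^ (1 + δ) : ℝ) : ℂ) := by
    rcases eq_or_ne n 0 with rfl | hn
    · simp
    · rw [LSeries.term_of_ne_zero hn]
      push_cast [Complex.ofReal_cpow (Nat.cast_nonneg n)]
      rfl
  have hsum := ArithmeticFunction.LSeriesSummable_vonMangoldt h1
  rw [LSeriesSummable, funext hterm, Complex.summable_ofReal] at hsum
  refine ⟨hsum, ?_⟩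
  have heq := eqOn_LFunctionResidueClassAux (a := (1 : ZMod 1)) isUnit_one h1
  simp only [hres] at heq
  rw [LSeries, tsum_congr hterm, ← Complex.ofReal_tsum] at heq
  have hre := congrArg Complex.re heq
  have hb := hC (1 + δ) ⟨by linarith [hδ.1], by linarith [hδ.2]⟩
  have h3 : ((((Nat.totient 1 : ℕ) : ℂ))⁻¹ / (((1 + δ : ℝ) : ℂ) - 1)) = ((1 / δ : ℝ) : ℂ) := by
    push_cast; simp
  rw [h3, ← Complex.ofReal_sub, Complex.ofReal_re] at hre
  rw [hre, Real.norm_eq_abs] at hb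
  have hC0 : 0 ≤ C := (abs_nonneg _).trans hb
  have := (abs_le.1 hb).2
  have h4 : C ≤ C / δ := le_div_self hC0 hδ.1 hδ.2
  rw [add_div]; linarith

lemma exists_tsum_primes_log_le : ∃ B : ℝ, ∀ δ ∈ Set.Ioc (0 : ℝ) 1,
    Summable (fun p : Nat.Primes ↦ Real.log p * (p : ℝ) ^ (-(1 + δ))) ∧
    ∑' p : Nat.Primes, Real.log p * (p : ℝ) ^ (-(1 + δ)) ≤ B / δ := by
  obtain ⟨B, hB⟩ := exists_tsum_vonMangoldt_le
  refine ⟨B, fun δ hδ ↦ ?_⟩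
  obtain ⟨hs, hle⟩ := hB δ hδ
  have heq : (fun p : Nat.Primes ↦ Real.log p * (p : ℝ) ^ (-(1 + δ))) =
      (fun n : ℕ ↦ ArithmeticFunction.vonMangoldt n / (n : ℝ) ^ (1 + δ)) ∘
        (fun p : Nat.Primes ↦ (p : ℕ)) := by
    ext p
    rw [Function.comp_apply, ArithmeticFunction.vonMangoldt_apply_prime p.2,
      Real.rpow_neg (Nat.cast_nonneg _), div_eq_mul_inv]
  rw [heq]
  have hinj : Function.Injective fun p : Nat.Primes ↦ (p : ℕ) := Nat.Primes.coe_nat_injective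
  exact ⟨hs.comp_injective hinj, (tsum_comp_le_tsum_of_inj hs (fun n ↦ div_nonneg
    ArithmeticFunction.vonMangoldt_nonneg (Real.rpow_nonneg n.cast_nonneg _)) hinj).trans hle⟩

/-- Since `ζ` has neither a pole nor a zero at `1 + iγ`, the prime cosine sum stays bounded as the
exponent tends to `1`. -/
lemma exists_abs_tsum_primes_cos_le {γ : ℝ} (hγ : γ ≠ 0) : ∃ B : ℝ, ∀ δ ∈ Set.Ioc (0 : ℝ) 1,
    |∑' p : Nat.Primes, (p : ℝ) ^ (-(1 + δ)) * Real.cos (γ * Real.log p)| ≤ B := by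
  have hne (δ : ℝ) : (1 + δ + γ * Complex.I : ℂ) ≠ 1 := fun h ↦ hγ (by
    simpa using congrArg Complex.im h)
  have hcont : ContinuousOn (fun δ : ℝ ↦ Real.log ‖riemannZeta (1 + δ + γ * Complex.I)‖)
      (Set.Icc 0 1) := by
    refine ContinuousOn.log (ContinuousOn.norm fun δ _ ↦ ?_) fun δ hδ ↦ ?_
    · exact ContinuousAt.continuousWithinAt
        (ContinuousAt.comp (f := fun δ : ℝ ↦ (1 + δ + γ * Complex.I : ℂ))
          (differentiableAt_riemannZeta (hne δ)).continuousAt (by fun_prop))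
    · exact norm_ne_zero_iff.2 (riemannZeta_ne_zero_of_one_le_re (by simpa using hδ.1))
  obtain ⟨C, hC⟩ := isCompact_Icc.exists_bound_of_continuousOn hcont
  have hsq : Summable fun p : Nat.Primes ↦ (p : ℝ) ^ (-2 : ℝ) :=
    Nat.Primes.summable_rpow.2 (by norm_num)
  refine ⟨C + ∑' p : Nat.Primes, (p : ℝ) ^ (-2 : ℝ), fun δ hδ ↦ ?_⟩
  set s : ℂ := 1 + δ + γ * Complex.I with hs_def
  have hs : 1 < s.re := by simpa [hs_def] using hδ.1
  have hp0 (p : Nat.Primes) : (0 : ℝ) < p := by exact_mod_cast p.2.pos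
  have hnorm (p : Nat.Primes) : ‖(p : ℂ) ^ (-s)‖ = (p : ℝ) ^ (-(1 + δ)) := by
    rw [Complex.norm_natCast_cpow_of_pos p.2.pos]
    simp [hs_def]
  have hre (p : Nat.Primes) :
      ((p : ℂ) ^ (-s)).re = (p : ℝ) ^ (-(1 + δ)) * Real.cos (γ * Real.log p) := by
    rw [Complex.cpow_def_of_ne_zero (by exact_mod_cast p.2.ne_zero), ← Complex.natCast_log,
      Complex.exp_re, Real.rpow_def_of_pos (hp0 p)]
    generalize Real.log p = L
    simp [hs_def, mul_comm γ]
  have hlog : Summable fun p : Nat.Primes ↦ -Complex.log (1 - (p : ℂ) ^ (-s)) := by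
    refine Summable.neg (Summable.clog_one_sub (Summable.of_norm ?_))
    simp only [hnorm]
    exact Nat.Primes.summable_rpow.2 (by linarith [hδ.1])
  have hz : Summable fun p : Nat.Primes ↦ (p : ℂ) ^ (-s) := by
    refine Summable.of_norm ?_
    simp only [hnorm]
    exact Nat.Primes.summable_rpow.2 (by linarith [hδ.1])
  have hdiff (p : Nat.Primes) :
      ‖-Complex.log (1 - (p : ℂ) ^ (-s)) - (p : ℂ) ^ (-s)‖ ≤ (p : ℝ) ^ (-2 : ℝ) := by
    have h2 : (2 : ℝ) ≤ p := by exact_mod_cast p.2.two_le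
    have hle : ‖(p : ℂ) ^ (-s)‖ ≤ (p : ℝ)⁻¹ := by
      rw [hnorm, ← Real.rpow_neg_one]
      exact Real.rpow_le_rpow_of_exponent_le (by linarith) (by linarith [hδ.1])
    have hhalf : (p : ℝ)⁻¹ ≤ 1 / 2 := by
      rw [one_div]; exact inv_anti₀ (by norm_num) h2
    have hlt : ‖-(p : ℂ) ^ (-s)‖ < 1 := by rw [norm_neg]; linarith
    have := Complex.norm_log_one_add_sub_self_le hlt
    rw [norm_neg] at this
    calc _ = ‖Complex.log (1 + -(p : ℂ) ^ (-s)) - -(p : ℂ) ^ (-s)‖ := by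
          rw [← norm_neg]; congr 1; ring_nf
      _ ≤ _ := this
      _ ≤ ((p : ℝ)⁻¹) ^ 2 * 2 / 2 := by
          have h3 : 0 < 1 - ‖(p : ℂ) ^ (-s)‖ := by linarith
          gcongr
          rw [inv_le_comm₀ (by linarith) (by norm_num)]
          linarith
      _ = _ := by
          rw [Real.rpow_neg (hp0 p).le]
          norm_num
  have hzeta := congrArg norm (riemannZeta_eulerProduct_exp_log hs)
  rw [Complex.norm_exp] at hzeta
  have hlogz : |(∑' p : Nat.Primes, -Complex.log (1 - (p : ℂ) ^ (-s))).re| ≤ C := by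
    have := hC δ ⟨hδ.1.le, hδ.2⟩
    rwa [← hs_def, ← hzeta, Real.log_exp, Real.norm_eq_abs] at this
  have hsub : ‖∑' p : Nat.Primes, (-Complex.log (1 - (p : ℂ) ^ (-s)) - (p : ℂ) ^ (-s))‖ ≤
      ∑' p : Nat.Primes, (p : ℝ) ^ (-2 : ℝ) :=
    tsum_of_norm_bounded hsq.hasSum hdiff
  rw [hlog.tsum_sub hz] at hsub
  have hsub' := (Complex.abs_re_le_norm _).trans hsub
  rw [Complex.sub_re, abs_sub_comm] at hsub'
  have hfin : ∑' p : Nat.Primes, (p : ℝ) ^ (-(1 + δ)) * Real.cos (γ * Real.log p) =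
      (∑' p : Nat.Primes, (p : ℂ) ^ (-s)).re := by
    rw [Complex.re_tsum hz]
    exact tsum_congr fun p ↦ (hre p).symm
  rw [hfin]
  rw [abs_le] at *
  constructor <;> linarith [hsub'.1, hsub'.2, hlogz.1, hlogz.2]

lemma exists_abs_sum_primes_cos_div_le {γ : ℝ} (hγ : γ ≠ 0) : ∃ B : ℝ, ∀ N : ℕ, 3 ≤ N →
    |∑ p ∈ (range (N + 1)).filter Nat.Prime, Real.cos (γ * Real.log p) / p| ≤ B := by
  obtain ⟨B₁, hB₁⟩ := exists_tsum_primes_log_le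
  obtain ⟨B₂, hB₂⟩ := exists_abs_tsum_primes_cos_le hγ
  refine ⟨2 * B₁ + B₂, fun N hN ↦ ?_⟩
  have hlogN : 1 ≤ Real.log N := by
    rw [Real.le_log_iff_exp_le (by positivity)]
    have : (3 : ℝ) ≤ N := by exact_mod_cast hN
    linarith [Real.exp_one_lt_three]
  set δ : ℝ := 1 / Real.log N with hδ_def
  have hδ0 : 0 < δ := by positivity
  have hδ : δ ∈ Set.Ioc (0 : ℝ) 1 := ⟨hδ0, by rw [hδ_def, div_le_one] <;> linarith⟩
  obtain ⟨hs, hle⟩ := hB₁ δ hδ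
  have hp0 (p : Nat.Primes) : (0 : ℝ) < p := by exact_mod_cast p.2.pos
  set F : Nat.Primes → ℝ := fun p ↦
    if (p : ℕ) ≤ N then Real.cos (γ * Real.log p) / p else 0 with hF
  have hFsum : HasSum F
      (∑ p ∈ (range (N + 1)).filter Nat.Prime, Real.cos (γ * Real.log p) / p) := by
    have key : HasSum (Set.indicator {p : ℕ | p.Prime} fun n : ℕ ↦
        if n ≤ N then Real.cos (γ * Real.log n) / n else 0)
        (∑ p ∈ (range (N + 1)).filter Nat.Prime, Real.cos (γ * Real.log p) / p) := by
      have hval : ∑ p ∈ (range (N + 1)).filter Nat.Prime, Real.cos (γ * Real.log p) / p =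
          ∑ p ∈ (range (N + 1)).filter Nat.Prime, Set.indicator {p : ℕ | p.Prime} (fun n : ℕ ↦
            if n ≤ N then Real.cos (γ * Real.log n) / n else 0) p := by
        refine sum_congr rfl fun p hp ↦ ?_
        rw [mem_filter, mem_range, Nat.lt_succ_iff] at hp
        simp [Set.indicator, hp.1, hp.2]
      rw [hval]
      refine hasSum_sum_of_ne_finset_zero fun n hn ↦ ?_
      rw [mem_filter, mem_range, Nat.lt_succ_iff] at hn
      simp only [Set.indicator, Set.mem_ofPred_eq]
      split_ifs <;> tauto
    exact hasSum_subtype_iff_indicator.2 key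
  set g : Nat.Primes → ℝ := fun p ↦ (p : ℝ) ^ (-(1 + δ)) * Real.cos (γ * Real.log p) with hg
  have hgsum : Summable g := by
    refine Summable.of_norm_bounded (g := fun p : Nat.Primes ↦ (p : ℝ) ^ (-(1 + δ)))
      (Nat.Primes.summable_rpow.2 (by linarith)) fun p ↦ ?_
    rw [hg, norm_mul, Real.norm_of_nonneg (by positivity), Real.norm_eq_abs]
    exact mul_le_of_le_one_right (by positivity) (Real.abs_cos_le_one _)
  have hbound (p : Nat.Primes) :
      ‖F p - g p‖ ≤ 2 * δ * (Real.log p * (p : ℝ) ^ (-(1 + δ))) := by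
    have hlogp : 0 ≤ Real.log p := Real.log_natCast_nonneg _
    have hpow : 0 < (p : ℝ) ^ (-(1 + δ)) := Real.rpow_pos_of_pos (hp0 p) _
    have hcos := Real.abs_cos_le_one (γ * Real.log p)
    rw [Real.norm_eq_abs]
    by_cases h : (p : ℕ) ≤ N
    · have hu : δ * Real.log p ≤ 1 := by
        rw [hδ_def, div_mul_eq_mul_div, one_mul, div_le_one (by linarith)]
        exact Real.log_le_log (hp0 p) (by exact_mod_cast h)
      have hu0 : 0 ≤ δ * Real.log p := by positivity
      have hinv : (1 : ℝ) / p = (p : ℝ) ^ (-(1 + δ)) * Real.exp (δ * Real.log p) := by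
        rw [mul_comm δ, ← Real.rpow_def_of_pos (hp0 p), ← Real.rpow_add (hp0 p), one_div,
          ← Real.rpow_neg_one]
        congr 1; ring
      have heq : F p - g p = (p : ℝ) ^ (-(1 + δ)) * (Real.exp (δ * Real.log p) - 1) *
          Real.cos (γ * Real.log p) := by
        simp only [hF, hg, h, if_true]
        rw [div_eq_mul_one_div, hinv]; ring
      have hexp := Real.abs_exp_sub_one_le (x := δ * Real.log p) (by rwa [abs_of_nonneg hu0])
      rw [abs_of_nonneg hu0] at hexp
      rw [heq, abs_mul, abs_mul, abs_of_pos hpow]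
      calc _ ≤ (p : ℝ) ^ (-(1 + δ)) * (2 * (δ * Real.log p)) * 1 := by gcongr
        _ = _ := by ring
    · have hu : 1 ≤ δ * Real.log p := by
        rw [hδ_def, div_mul_eq_mul_div, one_mul, one_le_div (by linarith)]
        exact Real.log_le_log (by positivity) (by exact_mod_cast (not_le.1 h).le)
      simp only [hF, hg, h, if_false, zero_sub, abs_neg]
      rw [abs_mul, abs_of_pos hpow]
      calc _ ≤ (p : ℝ) ^ (-(1 + δ)) * 1 := by gcongr
        _ ≤ (p : ℝ) ^ (-(1 + δ)) * (2 * (δ * Real.log p)) := by gcongr; linarith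
        _ = _ := by ring
  have hdiff := tsum_of_norm_bounded (hs.mul_left (2 * δ)).hasSum hbound
  rw [hFsum.summable.tsum_sub hgsum, hFsum.tsum_eq, tsum_mul_left, Real.norm_eq_abs] at hdiff
  have hle' : 2 * δ * ∑' p : Nat.Primes, Real.log p * (p : ℝ) ^ (-(1 + δ)) ≤ 2 * B₁ := by
    calc _ ≤ 2 * δ * (B₁ / δ) := by gcongr
      _ = _ := by field_simp
  have h2 := hB₂ δ hδ
  rw [abs_le] at *
  constructor <;> linarith [hdiff.1, hdiff.2, h2.1, h2.2]

lemma abs_cos_log_div_succ_sub_le (γ : ℝ) {n : ℕ} (hn : 0 < n) :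
    |Real.cos (γ * Real.log (n + 1 : ℕ)) / (n + 1 : ℕ) - Real.cos (γ * Real.log n) / n| ≤
      (1 + |γ|) / (n * (n + 1)) := by
  have hn' : (0 : ℝ) < n := by exact_mod_cast hn
  have hlog : |Real.log (n + 1 : ℕ) - Real.log n| ≤ 1 / n := by
    rw [← Real.log_div (by positivity) hn'.ne', abs_of_nonneg]
    · refine (Real.log_le_sub_one_of_pos (by positivity)).trans (le_of_eq ?_)
      push_cast; field_simp; ring
    · refine Real.log_nonneg ?_
      rw [one_le_div hn']; push_cast; linarith
  have hcos : |Real.cos (γ * Real.log (n + 1 : ℕ)) - Real.cos (γ * Real.log n)| ≤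
      |γ| * (1 / n) := by
    refine (Real.abs_cos_sub_cos_le _ _).trans ?_
    rw [← mul_sub, abs_mul]
    gcongr
  have heq : Real.cos (γ * Real.log (n + 1 : ℕ)) / (n + 1 : ℕ) - Real.cos (γ * Real.log n) / n =
      (Real.cos (γ * Real.log (n + 1 : ℕ)) - Real.cos (γ * Real.log n)) * (1 / (n + 1)) -
        Real.cos (γ * Real.log n) * (1 / (n * (n + 1))) := by
    push_cast; field_simp; ring
  rw [heq]
  refine (abs_sub _ _).trans ?_
  rw [abs_mul, abs_mul, abs_of_pos (a := 1 / ((n : ℝ) + 1)) (by positivity),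
    abs_of_pos (a := 1 / ((n : ℝ) * (n + 1))) (by positivity)]
  calc _ ≤ |γ| * (1 / n) * (1 / (n + 1)) + 1 * (1 / (n * (n + 1))) := by
        gcongr
        exact Real.abs_cos_le_one _
    _ = _ := by field_simp; ring

lemma one_div_mul_log_le_log_log_sub (n : ℕ) :
    1 / ((n + 3) * Real.log (n + 3)) ≤
      Real.log (Real.log (n + 3)) - Real.log (Real.log (n + 2)) := by
  have hn : (0 : ℝ) ≤ n := n.cast_nonneg
  have h2 : 0 < Real.log (n + 2) := Real.log_pos (by linarith)
  have h3 : 0 < Real.log (n + 3) := Real.log_pos (by linarith)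
  have key : Real.log (n + 2) - Real.log (n + 3) ≤ -(1 / (n + 3)) := by
    rw [← Real.log_div (by positivity) (by positivity)]
    refine (Real.log_le_sub_one_of_pos (by positivity)).trans (le_of_eq ?_)
    field_simp; ring
  have := Real.log_le_sub_one_of_pos (div_pos h2 h3)
  rw [Real.log_div h2.ne' h3.ne'] at this
  have h4 : (Real.log (n + 2) - Real.log (n + 3)) / Real.log (n + 3) ≤
      -(1 / (n + 3)) / Real.log (n + 3) := by gcongr
  rw [sub_div, div_self h3.ne', neg_div, div_div] at h4
  linarith

/-- Partial summation: if the summatory function of `a` is `o(n / log n)`, then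
`∑_{n ≤ N} a n cos(γ log n) / n = o(log log N)`. -/
lemma sum_mul_cos_div_isLittleO_log_log (γ : ℝ) (a : ℕ → ℝ)
    (ha : (fun n : ℕ ↦ ∑ i ∈ range (n + 1), a i) =o[atTop] fun n : ℕ ↦ (n : ℝ) / Real.log n) :
    (fun N : ℕ ↦ ∑ n ∈ range (N + 1), Real.cos (γ * Real.log n) / n * a n) =o[atTop]
      fun N : ℕ ↦ Real.log (Real.log (N + 2)) := by
  set f : ℕ → ℝ := fun n ↦ Real.cos (γ * Real.log n) / n with hf
  set A : ℕ → ℝ := fun n ↦ ∑ i ∈ range (n + 1), a i with hA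
  set g : ℕ → ℝ := fun n ↦ Real.log (Real.log (n + 3)) - Real.log (Real.log (n + 2)) with hg
  have hsumg (N : ℕ) : ∑ i ∈ range N, g i =
      Real.log (Real.log (N + 2)) - Real.log (Real.log 2) := by
    have := sum_range_sub (fun n : ℕ ↦ Real.log (Real.log (n + 2))) N
    simp only [Nat.cast_zero, zero_add] at this
    rw [← this]
    refine sum_congr rfl fun i _ ↦ ?_
    simp only [hg]; push_cast; ring_nf
  have hLL : Tendsto (fun N : ℕ ↦ Real.log (Real.log (N + 2))) atTop atTop :=
    Real.tendsto_log_atTop.comp (Real.tendsto_log_atTop.comp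
      (tendsto_atTop_add_const_right _ _ tendsto_natCast_atTop_atTop))
  have hconst (b : ℝ) : (fun _ : ℕ ↦ b) =o[atTop] fun N : ℕ ↦ Real.log (Real.log (N + 2)) :=
    isLittleO_const_left.2 (Or.inr (tendsto_norm_atTop_atTop.comp hLL))
  have hg0 : 0 ≤ g := fun n ↦ by
    refine le_trans ?_ (one_div_mul_log_le_log_log_sub n)
    have : 0 < Real.log ((n : ℝ) + 3) := Real.log_pos (by linarith [n.cast_nonneg (α := ℝ)])
    positivity
  have hO : (fun n : ℕ ↦ (f (n + 1) - f n) * ((n : ℝ) / Real.log n)) =O[atTop] g := by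
    refine IsBigO.of_bound ((1 + |γ|) * 9) ?_
    filter_upwards [eventually_ge_atTop 2] with n hn
    have hn' : (2 : ℝ) ≤ n := by exact_mod_cast hn
    have hl : 0 < Real.log n := Real.log_pos (by linarith)
    have hl3 : Real.log (n + 3) ≤ 3 * Real.log n := by
      rw [show (3 : ℝ) * Real.log n = Real.log ((n : ℝ) ^ 3) by rw [Real.log_pow]; norm_num]
      exact Real.log_le_log (by linarith) (by nlinarith [sq_nonneg ((n : ℝ) - 2)])
    have hl30 : 0 < Real.log ((n : ℝ) + 3) := Real.log_pos (by linarith)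
    rw [norm_mul, Real.norm_eq_abs, Real.norm_of_nonneg (hg0 n),
      Real.norm_of_nonneg (by positivity)]
    calc _ ≤ (1 + |γ|) / (n * (n + 1)) * (n / Real.log n) := by
          gcongr
          exact abs_cos_log_div_succ_sub_le γ (by omega)
      _ = (1 + |γ|) * (1 / ((n + 1) * Real.log n)) := by field_simp
      _ ≤ (1 + |γ|) * (9 * (1 / ((n + 3) * Real.log (n + 3)))) := by
          gcongr
          rw [mul_one_div, div_le_div_iff₀ (by positivity) (by positivity)]
          calc 1 * ((n + 3) * Real.log (n + 3)) ≤ (3 * (n + 1)) * (3 * Real.log n) := by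
                rw [one_mul]; gcongr; linarith
            _ = _ := by ring
      _ ≤ (1 + |γ|) * (9 * g n) := by
          gcongr
          exact one_div_mul_log_le_log_log_sub n
      _ = _ := by ring
  have hterm : (fun n ↦ (f (n + 1) - f n) * A n) =o[atTop] g :=
    ((isBigO_refl (fun n ↦ f (n + 1) - f n) atTop).mul_isLittleO ha).trans_isBigO hO
  have hsum : (fun N ↦ ∑ i ∈ range N, (f (i + 1) - f i) * A i) =o[atTop]
      fun N : ℕ ↦ Real.log (Real.log (N + 2)) := by
    refine (hterm.sum_range hg0 ?_).trans_isBigO ?_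
    · simp only [hsumg]
      exact tendsto_atTop_add_const_right _ _ hLL
    · simp only [hsumg]
      exact (isBigO_refl _ _).sub (hconst _).isBigO
  have hbdry : (fun N ↦ f N * A N) =o[atTop] fun N : ℕ ↦ Real.log (Real.log (N + 2)) := by
    refine IsBigO.trans_isLittleO (g := fun _ : ℕ ↦ (1 : ℝ)) ?_ (hconst 1)
    refine IsBigO.of_bound 1 ?_
    filter_upwards [ha.bound one_pos, eventually_ge_atTop 3] with N hN hN3
    have hN0 : (3 : ℝ) ≤ N := by exact_mod_cast hN3
    have hlogN : 1 ≤ Real.log N := by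
      rw [Real.le_log_iff_exp_le (by positivity)]
      linarith [Real.exp_one_lt_three]
    have hf1 : ‖f N‖ ≤ 1 / N := by
      rw [hf, norm_div, Real.norm_natCast]
      gcongr
      exact Real.abs_cos_le_one _
    rw [one_mul, Real.norm_of_nonneg (r := (N : ℝ) / Real.log N) (by positivity)] at hN
    rw [norm_mul]
    calc ‖f N‖ * ‖A N‖ ≤ 1 / N * (N / Real.log N) := by gcongr
      _ = 1 / Real.log N := by field_simp
      _ ≤ 1 := by rw [div_le_one] <;> linarith
      _ = _ := by simp
  refine (hbdry.sub hsum).congr_left fun N ↦ ?_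
  simpa only [smul_eq_mul, Nat.add_sub_cancel] using (sum_range_by_parts f a (N + 1)).symm

lemma primeCounting_isBigO :
    (fun n : ℕ ↦ (Nat.primeCounting n : ℝ)) =O[atTop] fun n : ℕ ↦ (n : ℝ) / Real.log n := by
  refine IsBigO.of_bound (Real.log 4 + 1) ?_
  filter_upwards [tendsto_natCast_atTop_atTop.eventually
    (Chebyshev.eventually_primeCounting_le one_pos)] with n hn
  rw [Nat.floor_natCast, mul_div_assoc] at hn
  rwa [Real.norm_natCast, Real.norm_of_nonneg (by positivity)]

lemma log_log_floor_add_two_isBigO :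
    (fun x : ℝ ↦ Real.log (Real.log (⌊x⌋₊ + 2))) =O[atTop] fun x ↦ Real.log (Real.log x) := by
  have hL := Real.tendsto_log_atTop.comp Real.tendsto_log_atTop
  refine IsBigO.of_bound 2 ?_
  filter_upwards [hL.eventually_ge_atTop (Real.log 2), eventually_ge_atTop (2 : ℝ)] with x hx hx2
  rw [Function.comp_apply] at hx
  have hfl := Nat.floor_le (show (0 : ℝ) ≤ x by linarith)
  have hfl2 : (2 : ℝ) ≤ ⌊x⌋₊ := by exact_mod_cast Nat.le_floor (by exact_mod_cast hx2)
  have hlogx : 0 < Real.log x := Real.log_pos (by linarith)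
  have h1 : Real.log (⌊x⌋₊ + 2) ≤ 2 * Real.log x := by
    rw [show (2 : ℝ) * Real.log x = Real.log (x ^ 2) by rw [Real.log_pow]; norm_num]
    exact Real.log_le_log (by linarith) (by nlinarith)
  have h2 : 1 ≤ Real.log ((⌊x⌋₊ : ℝ) + 2) := by
    rw [Real.le_log_iff_exp_le (by positivity)]
    linarith [Real.exp_one_lt_three]
  have h3 : Real.log (Real.log (⌊x⌋₊ + 2)) ≤ Real.log 2 + Real.log (Real.log x) := by
    rw [← Real.log_mul two_ne_zero hlogx.ne']
    exact Real.log_le_log (by linarith) h1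
  rw [Real.norm_of_nonneg (Real.log_nonneg h2),
    Real.norm_of_nonneg ((Real.log_nonneg one_le_two).trans hx)]
  linarith

/-- If `(c_p)` is bounded and has mean value `K₀` over primes, then for `γ ≠ 0`,
`∑_{p ≤ x} c_p cos(γ ln p)/p = o(ln ln x)`. -/
theorem sum_cp_cos_isLittleO (γ : ℝ) (hγ : γ ≠ 0) (c : ℕ → ℝ) (C : ℝ)
    (hc : ∀ p : ℕ, p.Prime → |c p| ≤ C) (K₀ : ℝ)
    (hmean : Tendsto (fun N : ℕ =>
        (∑ p ∈ Finset.filter Nat.Prime (Finset.range (N + 1)), c p)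
          / (Nat.primeCounting N : ℝ))
      atTop (nhds K₀)) :
    (fun x : ℝ =>
        ∑ p ∈ Finset.filter Nat.Prime (Finset.range (⌊x⌋₊ + 1)),
          c p * Real.cos (γ * Real.log p) / p)
      =o[atTop] (fun x : ℝ => Real.log (Real.log x)) := by
  have hcount (N : ℕ) : (#((range (N + 1)).filter Nat.Prime) : ℝ) = Nat.primeCounting N := by
    rw [Nat.primeCounting, Nat.primeCounting', Nat.count_eq_card_filter_range]
  have hmain := sum_mul_cos_div_isLittleO_log_log γ (fun p ↦ if p.Prime then c p - K₀ else 0) (by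
    refine IsLittleO.trans_isBigO ?_ primeCounting_isBigO
    refine (isLittleO_iff_tendsto' ?_).2 ?_
    · filter_upwards [eventually_ge_atTop 2] with N hN h0
      have : Nat.primeCounting N ≠ 0 := by rw [Ne, Nat.primeCounting_eq_zero_iff]; omega
      exact absurd (Nat.cast_eq_zero.1 h0) this
    · have hlim := hmean.sub_const K₀
      rw [sub_self] at hlim
      refine hlim.congr' ?_
      filter_upwards [eventually_ge_atTop 2] with N hN
      have : Nat.primeCounting N ≠ 0 := by rw [Ne, Nat.primeCounting_eq_zero_iff]; omega
      rw [← sum_filter, sum_sub_distrib, sum_const, nsmul_eq_mul, hcount]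
      field_simp)
  obtain ⟨B, hB⟩ := exists_abs_sum_primes_cos_div_le hγ
  have hLL : Tendsto (fun N : ℕ ↦ Real.log (Real.log (N + 2))) atTop atTop :=
    Real.tendsto_log_atTop.comp (Real.tendsto_log_atTop.comp
      (tendsto_atTop_add_const_right _ _ tendsto_natCast_atTop_atTop))
  have hcos : (fun N : ℕ ↦ ∑ p ∈ (range (N + 1)).filter Nat.Prime,
      Real.cos (γ * Real.log p) / p) =o[atTop] fun N : ℕ ↦ Real.log (Real.log (N + 2)) := by
    refine IsBigO.trans_isLittleO (g := fun _ : ℕ ↦ (1 : ℝ)) ?_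
      (isLittleO_const_left.2 (Or.inr (tendsto_norm_atTop_atTop.comp hLL)))
    refine IsBigO.of_bound B ?_
    filter_upwards [eventually_ge_atTop 3] with N hN
    simpa using hB N hN
  refine IsLittleO.trans_isBigO ?_ log_log_floor_add_two_isBigO
  refine ((hmain.add (hcos.const_mul_left K₀)).comp_tendsto
    (tendsto_nat_floor_atTop (α := ℝ))).congr_left fun x ↦ ?_
  simp only [Function.comp_apply, mul_ite, mul_zero]
  rw [← sum_filter, mul_sum, ← sum_add_distrib]
  exact sum_congr rfl fun p _ ↦ by ring
end
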